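/- arXiv:2504.04856 — 2 statements merged into one kernel-verified Lean document; each statement's English description precedes it below -/
import Mathlib

section
/- Let A be a nonempty finite type and let K be a Hermitian complex matrix indexed by (A × A) × (A × A). Then the following are equivalent: (i) Re Tr(K·J) ≥ 0 for every matrix J indexed by A × A with T_A(J) positive semidefinite and Tr_B(J) = λ • 1 for some real λ ≥ 0, and moreover Tr_B(S ★ K) = 0; (ii) there exists a Hermitian positive semidefinite matrix ω indexed by A × A with ⟨Φ₊, ω Φ₊⟩ = 0 (where Φ₊ is the vector with entries Φ₊ (i,k) = if i = k then 1 else 0) such that K = T_A(ω) − (Tr_B( S ★ T_A(ω) )) ⊗ₖ 1. -/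
open Matrix
open scoped Kronecker ComplexOrder

noncomputable def jordan {n : Type*} [Fintype n] (X Y : Matrix n n ℂ) : Matrix n n ℂ :=
  (2 : ℂ)⁻¹ • (X * Y + Y * X)

noncomputable def trB {A B : Type*} [Fintype B] (M : Matrix (A × B) (A × B) ℂ) : Matrix A A ℂ :=
  Matrix.of fun i j => ∑ k, M (i, k) (j, k)

noncomputable def trA {A B : Type*} [Fintype A] (M : Matrix (A × B) (A × B) ℂ) : Matrix B B ℂ :=
  Matrix.of fun k l => ∑ i, M (i, k) (i, l)

def ptA {A B : Type*} (M : Matrix (A × B) (A × B) ℂ) : Matrix (A × B) (A × B) ℂ :=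
  Matrix.of fun p q => M (q.1, p.2) (p.1, q.2)

def swap (A : Type*) [DecidableEq A] : Matrix (A × A) (A × A) ℂ :=
  Matrix.of fun p q => if p.1 = q.2 ∧ p.2 = q.1 then 1 else 0

def IsState {A : Type*} [Fintype A] (ρ : Matrix A A ℂ) : Prop :=
  ρ.PosSemidef ∧ ρ.trace = 1

def IsJam {A B : Type*} [Fintype A] [Fintype B] [DecidableEq A]
    (J : Matrix (A × B) (A × B) ℂ) : Prop :=
  (ptA J).PosSemidef ∧ trB J = 1

noncomputable def cost {A B : Type*} [Fintype A] [Fintype B] [DecidableEq A] [DecidableEq B]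
    (K : Matrix (A × B) (A × B) ℂ) (ρ : Matrix A A ℂ) (σ : Matrix B B ℂ) : ℝ :=
  sInf { r : ℝ | ∃ J : Matrix (A × B) (A × B) ℂ, IsJam J ∧
      trA ((ρ ⊗ₖ (1 : Matrix B B ℂ)) * J) = σ ∧
      r = (Matrix.trace (K * jordan (ρ ⊗ₖ (1 : Matrix B B ℂ)) J)).re }

/-- The unnormalised maximally entangled vector `Φ₊`. -/
def PhiPlus (A : Type*) [DecidableEq A] : A × A → ℂ :=
  fun p => if p.1 = p.2 then 1 else 0

section

open scoped Matrix.Norms.Elementwise MatrixOrder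
variable {n : Type*} [Fintype n]

theorem Matrix.PosSemidef.norm_apply_le_trace {M : Matrix n n ℂ} (hM : M.PosSemidef) (i j : n) :
    ‖M i j‖ ≤ M.trace.re := by
  classical
  obtain ⟨B, rfl⟩ := CStarAlgebra.nonneg_iff_eq_star_mul_self.mp hM.nonneg
  have hdiag (l : n) : ∑ k, ‖B k l‖ ^ 2 ≤ (star B * B).trace.re := by
    have key (l : n) : ((star B * B) l l).re = ∑ k, ‖B k l‖ ^ 2 := by
      simp [Matrix.mul_apply, Complex.sq_norm, Complex.normSq_apply]
    simp only [Matrix.trace, Matrix.diag, Complex.re_sum, key]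
    exact Finset.single_le_sum (f := fun l => ∑ k, ‖B k l‖ ^ 2)
      (fun _ _ => by positivity) (Finset.mem_univ l)
  calc ‖(star B * B) i j‖ ≤ ∑ k, ‖B k i‖ * ‖B k j‖ := by
        simpa [Matrix.mul_apply] using norm_sum_le Finset.univ fun k => star (B k i) * B k j
    _ ≤ ∑ k, (‖B k i‖ ^ 2 + ‖B k j‖ ^ 2) / 2 :=
        Finset.sum_le_sum fun k _ => by nlinarith [sq_nonneg (‖B k i‖ - ‖B k j‖)]
    _ ≤ (star B * B).trace.re := by
        rw [← Finset.sum_div, Finset.sum_add_distrib]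
        linarith [hdiag i, hdiag j]

theorem Matrix.isClosed_setOf_posSemidef : IsClosed {M : Matrix n n ℂ | M.PosSemidef} := by
  simp only [posSemidef_iff_dotProduct_mulVec, Matrix.IsHermitian, Set.ofPred_and, Set.ofPred_forall]
  refine (isClosed_eq (by fun_prop) (by fun_prop)).inter (isClosed_iInter fun x => ?_)
  exact isClosed_le (by fun_prop) (by fun_prop)

theorem Matrix.exists_forall_eq_re_trace_mul [DecidableEq n] (f : Matrix n n ℂ →ₗ[ℝ] ℝ) :
    ∃ J : Matrix n n ℂ, ∀ X, f X = (X * J).trace.re := by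
  refine ⟨Matrix.of fun l k => ⟨f (single k l 1), - f (single k l Complex.I)⟩, fun X => ?_⟩
  have hX (i j : n) : f (single i j (X i j)) =
      (X i j).re * f (single i j 1) + (X i j).im * f (single i j Complex.I) := by
    rw [← smul_eq_mul, ← smul_eq_mul, ← map_smul, ← map_smul, ← map_add, smul_single, smul_single,
      ← single_add]
    congr 2
    apply Complex.ext <;> simp
  conv_lhs => rw [matrix_eq_sum_single X]
  simp [Matrix.trace, Matrix.mul_apply, hX]

/-- Conic duality for the positive semidefinite cone and a real subspace of traceless matrices. -/
theorem exists_posSemidef_sub_mem [DecidableEq n] (W : Submodule ℝ (Matrix n n ℂ))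
    (htr : ∀ w ∈ W, w.trace = 0) (hstar : ∀ w ∈ W, wᴴ ∈ W) {K : Matrix n n ℂ} (hK : K.IsHermitian)
    (h : ∀ J : Matrix n n ℂ, J.PosSemidef → (∀ w ∈ W, (w * J).trace.re = 0) →
      0 ≤ (K * J).trace.re) :
    ∃ ω : Matrix n n ℂ, ω.PosSemidef ∧ K - ω ∈ W := by
  have hWc : IsClosed (W : Set (Matrix n n ℂ)) := W.closed_of_finiteDimensional
  have : SequentialSpace (Matrix n n ℂ) := inferInstanceAs (SequentialSpace (n → n → ℂ))
  have : LocallyConvexSpace ℝ (Matrix n n ℂ) :=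
    inferInstanceAs (LocallyConvexSpace ℝ (n → n → ℂ))
  let C : ProperCone ℝ (Matrix n n ℂ) :=
    { carrier := {X | ∃ ω : Matrix n n ℂ, ω.PosSemidef ∧ X - ω ∈ W}
      add_mem' := by
        rintro X Y ⟨p, hp, hX⟩ ⟨q, hq, hY⟩
        exact ⟨p + q, hp.add hq, by simpa [add_sub_add_comm] using W.add_mem hX hY⟩
      zero_mem' := ⟨0, .zero, by simp⟩
      smul_mem' := by
        rintro c X ⟨p, hp, hX⟩
        refine ⟨(c : ℝ) • p, hp.smul c.2, ?_⟩
        have := W.smul_mem (c : ℝ) hX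
        rwa [smul_sub] at this
      isClosed' := by
        refine IsSeqClosed.isClosed fun x X hx hlim => ?_
        choose p hp hxp using hx
        have htrace (k : ℕ) : (p k).trace = (x k).trace := by
          have := htr _ (hxp k)
          rw [trace_sub, sub_eq_zero] at this
          exact this.symm
        obtain ⟨R, hR⟩ := (((continuous_id.matrix_trace.tendsto X).comp hlim).norm).bddAbove_range
        have hball (k : ℕ) : p k ∈ Metric.closedBall 0 R := by
          have hk : ‖(x k).trace‖ ≤ R := hR ⟨k, rfl⟩
          rw [mem_closedBall_zero_iff, Matrix.norm_le_iff ((norm_nonneg _).trans hk)]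
          intro i j
          refine ((hp k).norm_apply_le_trace i j).trans ((Complex.re_le_norm _).trans ?_)
          rwa [htrace k]
        have : ProperSpace (Matrix n n ℂ) := FiniteDimensional.proper ℝ _
        obtain ⟨ω, -, φ, hφ, hω⟩ :=
          (isCompact_closedBall (0 : Matrix n n ℂ) R).tendsto_subseq hball
        exact ⟨ω, isClosed_setOf_posSemidef.mem_of_tendsto hω (.of_forall fun k => hp _),
          hWc.mem_of_tendsto ((hlim.comp hφ.tendsto_atTop).sub hω) (.of_forall fun k => hxp _)⟩ }
  by_contra hcon
  obtain ⟨f, hf, hfK⟩ := C.hyperplane_separation_point (x₀ := K) hcon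
  obtain ⟨J, hJ⟩ := exists_forall_eq_re_trace_mul f.toLinearMap
  have hP (p : Matrix n n ℂ) (hp : p.PosSemidef) : 0 ≤ f p := hf p ⟨p, hp, by simp⟩
  have hW (w) (hw : w ∈ W) : f w = 0 := by
    have h₁ := hf w ⟨0, .zero, by simpa using hw⟩
    have h₂ := hf (-w) ⟨0, .zero, by simpa using hw⟩
    rw [map_neg] at h₂
    linarith
  have hJ' (X : Matrix n n ℂ) : f X = (X * J).trace.re := hJ X
  have hadj (X : Matrix n n ℂ) : (X * Jᴴ).trace.re = f Xᴴ := by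
    rw [hJ', ← Complex.conj_re, starRingEnd_apply, ← trace_conjTranspose, conjTranspose_mul,
      conjTranspose_conjTranspose, trace_mul_comm]
  have hsum (X : Matrix n n ℂ) : (X * (J + Jᴴ)).trace.re = f X + f Xᴴ := by
    rw [mul_add, trace_add, Complex.add_re, hadj, hJ' X]
  have hherm : (J + Jᴴ).IsHermitian := isHermitian_add_transpose_self J
  have hpsd : (J + Jᴴ).PosSemidef := by
    refine .of_dotProduct_mulVec_nonneg hherm fun v => ?_
    rw [Complex.nonneg_iff]
    constructor
    · have hv := hP _ (posSemidef_vecMulVec_self_star v)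
      have := hsum (vecMulVec v (star v))
      rw [vecMulVec_mul, trace_vecMulVec, dotProduct_comm, ← dotProduct_mulVec] at this
      rw [this, (posSemidef_vecMulVec_self_star v).isHermitian.eq]
      linarith
    · exact (hherm.im_star_dotProduct_mulVec_self v).symm
  have := h _ hpsd fun w hw => by rw [hsum, hW _ hw, hW _ (hstar w hw), add_zero]
  rw [hsum, hK.eq] at this
  linarith

end

section PartialTrace
variable {A B : Type*}

theorem ptA_ptA (M : Matrix (A × B) (A × B) ℂ) : ptA (ptA M) = M := rfl

theorem ptA_add (M N : Matrix (A × B) (A × B) ℂ) : ptA (M + N) = ptA M + ptA N := rfl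

theorem Matrix.IsHermitian.ptA {M : Matrix (A × B) (A × B) ℂ} (hM : M.IsHermitian) :
    (ptA M).IsHermitian := by
  ext p q
  exact hM.apply (q.1, p.2) (p.1, q.2)

theorem ptA_kronecker_one [DecidableEq B] (X : Matrix A A ℂ) :
    ptA (X ⊗ₖ (1 : Matrix B B ℂ)) = Xᵀ ⊗ₖ (1 : Matrix B B ℂ) := rfl

theorem trB_ptA [Fintype B] (M : Matrix (A × B) (A × B) ℂ) : trB (ptA M) = (trB M)ᵀ := rfl

theorem trB_add [Fintype B] (M N : Matrix (A × B) (A × B) ℂ) :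
    trB (M + N) = trB M + trB N := by
  ext i j
  simp [trB, Finset.sum_add_distrib]

theorem Matrix.IsHermitian.trB [Fintype B] {M : Matrix (A × B) (A × B) ℂ} (hM : M.IsHermitian) :
    (trB M).IsHermitian := by
  ext i j
  simp only [_root_.trB, conjTranspose_apply, of_apply, star_sum]
  exact Finset.sum_congr rfl fun k _ => hM.apply _ _

variable [Fintype A] [Fintype B]

theorem trace_trB (M : Matrix (A × B) (A × B) ℂ) : (trB M).trace = M.trace := by
  simp [trB, Matrix.trace, Fintype.sum_prod_type]

theorem trace_ptA_mul_ptA (M N : Matrix (A × B) (A × B) ℂ) :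
    (ptA M * ptA N).trace = (M * N).trace := by
  simp only [ptA, Matrix.trace, diag_apply, Matrix.mul_apply, of_apply, Fintype.sum_prod_type]
  calc ∑ i, ∑ k, ∑ j, ∑ l, M (j, k) (i, l) * N (i, l) (j, k)
      = ∑ i, ∑ j, ∑ k, ∑ l, M (j, k) (i, l) * N (i, l) (j, k) :=
        Finset.sum_congr rfl fun _ _ => Finset.sum_comm
    _ = ∑ j, ∑ i, ∑ k, ∑ l, M (j, k) (i, l) * N (i, l) (j, k) := Finset.sum_comm
    _ = ∑ j, ∑ k, ∑ i, ∑ l, M (j, k) (i, l) * N (i, l) (j, k) :=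
        Finset.sum_congr rfl fun _ _ => Finset.sum_comm

theorem trace_kronecker_one_mul [DecidableEq B] (X : Matrix A A ℂ)
    (M : Matrix (A × B) (A × B) ℂ) :
    (X ⊗ₖ (1 : Matrix B B ℂ) * M).trace = (X * trB M).trace := by
  simp only [trB, Matrix.trace, diag_apply, Matrix.mul_apply, of_apply, Fintype.sum_prod_type,
    kroneckerMap_apply, Matrix.one_apply, mul_ite, ite_mul, mul_one, mul_zero, zero_mul,
    Finset.sum_ite_eq, Finset.mem_univ, if_true, Finset.mul_sum]
  exact Finset.sum_congr rfl fun _ _ => Finset.sum_comm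

end PartialTrace

section Swap
variable {A : Type*} [Fintype A] [DecidableEq A]

theorem swap_mul_apply (M : Matrix (A × A) (A × A) ℂ) (p q : A × A) :
    (swap A * M) p q = M p.swap q := by
  rw [Matrix.mul_apply, Finset.sum_eq_single p.swap]
  · simp [_root_.swap]
  · rintro ⟨a, b⟩ - h
    rw [_root_.swap, of_apply, if_neg, zero_mul]
    rintro ⟨h₁, h₂⟩
    exact h (Prod.ext h₂.symm h₁.symm)
  · simp

theorem mul_swap_apply (M : Matrix (A × A) (A × A) ℂ) (p q : A × A) :
    (M * swap A) p q = M p q.swap := by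
  rw [Matrix.mul_apply, Finset.sum_eq_single q.swap]
  · simp [_root_.swap]
  · rintro ⟨a, b⟩ - h
    rw [_root_.swap, of_apply, if_neg, mul_zero]
    rintro ⟨h₁, h₂⟩
    exact h (Prod.ext h₁ h₂)
  · simp

theorem trB_jordan_swap_apply (M : Matrix (A × A) (A × A) ℂ) (i j : A) :
    trB (jordan (swap A) M) i j = 2⁻¹ * ∑ k, (M (k, i) (j, k) + M (i, k) (k, j)) := by
  simp [trB, jordan, swap_mul_apply, mul_swap_apply, Finset.mul_sum]

theorem trB_jordan_swap_add (M N : Matrix (A × A) (A × A) ℂ) :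
    trB (jordan (swap A) (M + N)) = trB (jordan (swap A) M) + trB (jordan (swap A) N) := by
  rw [← trB_add, jordan, jordan, jordan, ← smul_add, mul_add, add_mul]
  congr 2
  abel

theorem trB_jordan_swap_kronecker_one (X : Matrix A A ℂ) :
    trB (jordan (swap A) (X ⊗ₖ (1 : Matrix A A ℂ))) = X := by
  ext i j
  simp only [trB_jordan_swap_apply, kroneckerMap_apply, Matrix.one_apply, mul_ite, mul_one,
    mul_zero, Finset.sum_add_distrib, Finset.sum_ite_eq, Finset.sum_ite_eq', Finset.mem_univ,
    if_true]
  ring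

theorem trace_trB_jordan_swap_ptA (ω : Matrix (A × A) (A × A) ℂ) :
    (trB (jordan (swap A) (ptA ω))).trace =
      star (PhiPlus A) ⬝ᵥ ω.mulVec (PhiPlus A) := by
  have hR : star (PhiPlus A) ⬝ᵥ ω.mulVec (PhiPlus A) = ∑ i, ∑ k, ω (i, i) (k, k) := by
    simp [dotProduct, mulVec, PhiPlus, Fintype.sum_prod_type, apply_ite]
  have hcomm : ∑ i, ∑ k, ω (k, k) (i, i) = ∑ i, ∑ k, ω (i, i) (k, k) := Finset.sum_comm
  rw [hR, Matrix.trace]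
  simp only [diag_apply, trB_jordan_swap_apply, ptA, of_apply, Finset.sum_add_distrib,
    ← Finset.mul_sum, hcomm]
  ring

end Swap

/-- The real subspace of matrices `X ⊗ₖ 1` with `X` traceless. -/
def tracelessKronOne (A B : Type*) [Fintype A] [DecidableEq B] :
    Submodule ℝ (Matrix (A × B) (A × B) ℂ) where
  carrier := {M | ∃ X : Matrix A A ℂ, X.trace = 0 ∧ M = X ⊗ₖ (1 : Matrix B B ℂ)}
  add_mem' := by
    rintro _ _ ⟨X, hX, rfl⟩ ⟨Y, hY, rfl⟩
    exact ⟨X + Y, by simp [hX, hY], (add_kronecker X Y 1).symm⟩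
  zero_mem' := ⟨0, by simp, by simp⟩
  smul_mem' := by
    rintro c _ ⟨X, hX, rfl⟩
    exact ⟨c • X, by simp [hX], (smul_kronecker c X 1).symm⟩

theorem trB_eq_smul_one {A B : Type*} [Fintype A] [Nonempty A] [Fintype B] [DecidableEq A]
    [DecidableEq B] {J : Matrix (A × B) (A × B) ℂ} (hJ : J.IsHermitian)
    (h : ∀ w ∈ tracelessKronOne A B, (w * J).trace.re = 0) :
    trB J = (J.trace.re / Fintype.card A) • (1 : Matrix A A ℂ) := by
  set c : ℝ := J.trace.re / Fintype.card A with hc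
  have hcard : (Fintype.card A : ℂ) ≠ 0 := by simp
  have htr : ((J.trace.re : ℝ) : ℂ) = J.trace := by
    apply Complex.conj_eq_iff_re.mp
    rw [starRingEnd_apply, ← trace_conjTranspose, hJ.eq]
  have hX : (trB J - c • (1 : Matrix A A ℂ)).trace = 0 := by
    rw [trace_sub, trace_trB, trace_smul, trace_one, Complex.real_smul, hc]
    push_cast
    rw [htr, div_mul_cancel₀ _ hcard, sub_self]
  have hXherm : (trB J - c • (1 : Matrix A A ℂ))ᴴ = trB J - c • (1 : Matrix A A ℂ) := by
    simp [conjTranspose_sub, hJ.trB.eq]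
  have hre := h _ ⟨_, hX, rfl⟩
  rw [trace_kronecker_one_mul] at hre
  have hsq : ((trB J - c • (1 : Matrix A A ℂ))ᴴ * (trB J - c • (1 : Matrix A A ℂ))).trace.re
      = 0 := by
    rw [hXherm, mul_sub, trace_sub, Matrix.mul_smul, mul_one, trace_smul, hX, smul_zero, sub_zero,
      hre]
  rw [← sub_eq_zero, ← trace_conjTranspose_mul_self_eq_zero_iff]
  have hnn := (posSemidef_conjTranspose_mul_self (trB J - c • (1 : Matrix A A ℂ))).trace_nonneg
  exact Complex.ext hsq (Complex.nonneg_iff.mp hnn).2.symm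

theorem Matrix.PosSemidef.re_trace_mul_nonneg {n : Type*} [Fintype n] {P Q : Matrix n n ℂ}
    (hP : P.PosSemidef) (hQ : Q.PosSemidef) : 0 ≤ (P * Q).trace.re := by
  classical
  open scoped Matrix.Norms.L2Operator MatrixOrder in
  obtain ⟨R, rfl⟩ := CStarAlgebra.nonneg_iff_eq_star_mul_self.mp hP.nonneg
  rw [star_eq_conjTranspose, trace_mul_cycle, trace_mul_comm, ← mul_assoc]
  exact (Complex.nonneg_iff.mp (hQ.mul_mul_conjTranspose_same R).trace_nonneg).1

theorem stmt9 {A : Type*} [Fintype A] [Nonempty A] [DecidableEq A]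
    (K : Matrix (A × A) (A × A) ℂ) (hK : K.IsHermitian) :
    ((∀ J : Matrix (A × A) (A × A) ℂ, (ptA J).PosSemidef →
        (∃ lam : ℝ, 0 ≤ lam ∧ trB J = lam • (1 : Matrix A A ℂ)) →
        0 ≤ (Matrix.trace (K * J)).re) ∧
      trB (jordan (swap A) K) = 0) ↔
    (∃ ω : Matrix (A × A) (A × A) ℂ, ω.PosSemidef ∧
        star (PhiPlus A) ⬝ᵥ ω.mulVec (PhiPlus A) = 0 ∧
        K = ptA ω - (trB (jordan (swap A) (ptA ω))) ⊗ₖ (1 : Matrix A A ℂ)) := by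
  constructor
  · rintro ⟨hpos, hswap⟩
    obtain ⟨ω, hω, X, hX, hKω⟩ := exists_posSemidef_sub_mem (tracelessKronOne A A)
      (by
        rintro _ ⟨X, hX, rfl⟩
        simp [trace_kronecker, hX])
      (by
        rintro _ ⟨X, hX, rfl⟩
        exact ⟨Xᴴ, by simp [hX], by simp [conjTranspose_kronecker]⟩)
      hK.ptA
      (fun J hJ hJW => by
        have := hpos (ptA J) hJ ⟨J.trace.re / Fintype.card A,
          div_nonneg (Complex.nonneg_iff.mp hJ.trace_nonneg).1 (Nat.cast_nonneg _), by
            rw [trB_ptA, trB_eq_smul_one hJ.isHermitian hJW, transpose_smul, transpose_one]⟩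
        rwa [← trace_ptA_mul_ptA, ptA_ptA] at this)
    have hKeq : K = ptA ω + Xᵀ ⊗ₖ (1 : Matrix A A ℂ) := by
      rw [← ptA_kronecker_one, ← ptA_add, ← hKω, add_sub_cancel, ptA_ptA]
    rw [hKeq, trB_jordan_swap_add, trB_jordan_swap_kronecker_one] at hswap
    have hXt := eq_neg_of_add_eq_zero_right hswap
    refine ⟨ω, hω, ?_, ?_⟩
    · rw [← trace_trB_jordan_swap_ptA, eq_neg_of_add_eq_zero_left hswap, trace_neg,
        trace_transpose, hX, neg_zero]
    · rw [eq_neg_of_add_eq_zero_left hswap, hKeq, ← neg_one_smul ℂ Xᵀ, smul_kronecker]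
      simp
  · rintro ⟨ω, hω, hΦ, hKeq⟩
    rw [← trace_trB_jordan_swap_ptA] at hΦ
    rw [sub_eq_add_neg, ← neg_one_smul ℂ (_ ⊗ₖ _), ← smul_kronecker] at hKeq
    refine ⟨fun J hJ ⟨c, _, hc⟩ => ?_, ?_⟩
    · rw [hKeq, add_mul, trace_add, trace_kronecker_one_mul, hc, ← trace_ptA_mul_ptA, ptA_ptA]
      simpa [hΦ] using hω.re_trace_mul_nonneg hJ
    · rw [hKeq, trB_jordan_swap_add, trB_jordan_swap_kronecker_one]
      simp
end

section
/- Let A be a nonempty finite type of cardinality d and let K be a Hermitian complex matrix indexed by (A × A) × (A × A). Then the following are equivalent: (i) K satisfies all three of: (a) Re Tr( K · ((ρ ⊗ₖ 1) ★ J) ) ≥ 0 for every state ρ on A and every Jamiołkowski matrix J from A to A; (b) Tr_B( S ★ K ) = 0; (c) (U ⊗ₖ U) · K = K · (U ⊗ₖ U) for every unitary matrix U indexed by A. (ii) There exists a real number a ≥ 0 such that K = a • (d • 1 − S). -/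
open Matrix
open scoped Kronecker ComplexOrder

theorem swapMatrix_apply {A : Type*} [DecidableEq A] (p q : A × A) :
    swap A p q = if p.1 = q.2 ∧ p.2 = q.1 then 1 else 0 :=
  rfl

theorem exists_perm_of_ne {A : Type*} [DecidableEq A] {a b c d : A} (hab : a ≠ b) (hcd : c ≠ d) :
    ∃ σ : Equiv.Perm A, σ a = c ∧ σ b = d := by
  refine ⟨(Equiv.swap a c).trans (Equiv.swap (Equiv.swap a c b) d), ?_, by simp⟩
  have : c ≠ Equiv.swap a c b := by
    intro h
    apply hab
    apply (Equiv.swap a c).injective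
    rw [← h, Equiv.swap_apply_left]
  simp [Equiv.swap_apply_of_ne_of_ne this hcd]

/-- Entrywise form of the covariance `(U ⊗ U) K = K (U ⊗ U)`. -/
theorem kronecker_comm_apply {A : Type*} [Fintype A] {U : Matrix A A ℂ}
    {K : Matrix (A × A) (A × A) ℂ}
    (h : (U ⊗ₖ U) * K = K * (U ⊗ₖ U)) (p q : A × A) :
    ∑ m, ∑ n, U p.1 m * U p.2 n * K (m, n) q = ∑ m, ∑ n, K p (m, n) * (U m q.1 * U n q.2) := by
  have := congrFun (congrFun h p) q
  simpa only [Matrix.mul_apply, Fintype.sum_prod_type, Matrix.kroneckerMap_apply] using this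

section Covariance

variable {A : Type*} [Fintype A] [DecidableEq A]

theorem diagonal_covariance {K : Matrix (A × A) (A × A) ℂ}
    (h : ∀ U : Matrix A A ℂ, Uᴴ * U = 1 → (U ⊗ₖ U) * K = K * (U ⊗ₖ U))
    (u : A → ℂ) (hu : ∀ i, star (u i) * u i = 1) (p q : A × A) :
    u p.1 * u p.2 * K p q = K p q * (u q.1 * u q.2) := by
  have hU : (diagonal u)ᴴ * diagonal u = 1 := by
    rw [diagonal_conjTranspose, diagonal_mul_diagonal, ← diagonal_one]
    congr 1
    funext i
    exact hu i
  have := congrFun (congrFun (h _ hU) p) q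
  rw [diagonal_kronecker_diagonal, diagonal_mul, mul_diagonal] at this
  exact this

/-- A covariant matrix only couples index pairs that agree up to order. -/
theorem covariant_apply_eq_zero {K : Matrix (A × A) (A × A) ℂ}
    (h : ∀ U : Matrix A A ℂ, Uᴴ * U = 1 → (U ⊗ₖ U) * K = K * (U ⊗ₖ U))
    {i k j l : A} (h₁ : ¬(i = j ∧ k = l)) (h₂ : ¬(i = l ∧ k = j)) :
    K (i, k) (j, l) = 0 := by
  have key : ∀ a : A, K (i, k) (j, l) = 0 ∨
      (if i = a then Complex.I else 1) * (if k = a then Complex.I else 1) =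
        (if j = a then Complex.I else 1) * (if l = a then Complex.I else 1) := by
    intro a
    have := diagonal_covariance h (fun b => if b = a then Complex.I else 1)
      (fun b => by by_cases hb : b = a <;> simp [hb]) (i, k) (j, l)
    rw [mul_comm] at this
    rcases mul_eq_mul_left_iff.1 this with h' | h'
    · exact Or.inr h'
    · exact Or.inl h'
  by_contra hK
  have I1 : Complex.I ≠ 1 := fun h => by simpa using congrArg Complex.re h
  have I2 : Complex.I ≠ -1 := fun h => by simpa using congrArg Complex.re h
  have I3 := Complex.I_mul_I
  have ki := (key i).resolve_left hK
  have kk := (key k).resolve_left hK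
  clear key h hK
  split_ifs at ki kk <;> grind

theorem perm_covariance {K : Matrix (A × A) (A × A) ℂ}
    (h : ∀ U : Matrix A A ℂ, Uᴴ * U = 1 → (U ⊗ₖ U) * K = K * (U ⊗ₖ U))
    (σ : Equiv.Perm A) (i k j l : A) :
    K (σ i, σ k) (σ j, σ l) = K (i, k) (j, l) := by
  let U : Matrix A A ℂ := Matrix.of fun i j => if σ i = j then 1 else 0
  have hU : Uᴴ * U = 1 := by
    ext a b
    rw [Matrix.mul_apply, ← Equiv.sum_comp σ.symm]
    simp [U, Matrix.one_apply, eq_comm]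
  have := kronecker_comm_apply (h U hU) (i, k) (σ j, σ l)
  simpa [U, ite_and, Finset.sum_ite_eq, Finset.sum_ite_eq', Finset.sum_ite_irrel] using this

/-- The reflection orthogonal to `e_a + 2 e_b` relates the diagonal coefficients. -/
theorem covariant_apply_self {K : Matrix (A × A) (A × A) ℂ}
    (h : ∀ U : Matrix A A ℂ, Uᴴ * U = 1 → (U ⊗ₖ U) * K = K * (U ⊗ₖ U))
    {a b : A} (hab : a ≠ b) :
    K (a, a) (a, a) = K (a, b) (a, b) + K (b, a) (a, b) := by
  let v : A → ℂ := Pi.single a 1 + Pi.single b 2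
  let U : Matrix A A ℂ := 1 - (2 / 5 : ℂ) • vecMulVec v v
  have hv : v ⬝ᵥ v = 5 := by
    simp [v, hab, hab.symm]
    norm_num
  have hs : star v = v := by
    funext i
    simp only [v, Pi.star_apply, Pi.add_apply, Pi.single_apply]
    split_ifs <;> simp
  have hU : Uᴴ * U = 1 := by
    have h1 : Uᴴ = U := by
      simp [U, conjTranspose_sub, conjTranspose_smul, conjTranspose_vecMulVec, hs]
    have h2 : vecMulVec v v * vecMulVec v v = (5 : ℂ) • vecMulVec v v := by
      rw [vecMulVec_mul_vecMulVec, hv]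
      ext i j
      simp only [vecMulVec_apply, Matrix.smul_apply, Pi.smul_apply, smul_eq_mul]
      ring
    rw [h1]
    simp only [U, sub_mul, mul_sub, one_mul, mul_one, smul_mul_assoc, mul_smul_comm, h2, smul_smul]
    module
  have haa : U a a = 3 / 5 := by
    simp [U, v, vecMulVec_apply, hab]
    norm_num
  have hba : U a b = -(4 / 5) := by
    simp [U, v, vecMulVec_apply, hab, hab.symm]
    norm_num
  have e := kronecker_comm_apply (h U hU) (a, a) (a, b)
  have eL : ∑ m, ∑ n, U a m * U a n * K (m, n) (a, b) =
      U a a * U a b * (K (a, b) (a, b) + K (b, a) (a, b)) := by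
    rw [← Fintype.sum_prod_type' (f := fun m n => U a m * U a n * K (m, n) (a, b)),
      ← Finset.sum_subset (Finset.subset_univ {(a, b), (b, a)}), Finset.sum_pair (by simp [hab])]
    · ring
    · rintro ⟨m, n⟩ - hmn
      simp only [Finset.mem_insert, Finset.mem_singleton, Prod.mk.injEq, not_or] at hmn
      rw [covariant_apply_eq_zero h hmn.1 hmn.2, mul_zero]
  have eR : ∑ m, ∑ n, K (a, a) (m, n) * (U m a * U n b) =
      U a a * U a b * K (a, a) (a, a) := by
    rw [← Fintype.sum_prod_type' (f := fun m n => K (a, a) (m, n) * (U m a * U n b)),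
      Finset.sum_eq_single (a, a)]
    · ring
    · rintro ⟨m, n⟩ - hmn
      rw [covariant_apply_eq_zero h (by simpa [eq_comm] using hmn)
        (by simpa [eq_comm, and_comm] using hmn), zero_mul]
    · simp
  have e' := eR.symm.trans (e.symm.trans eL)
  rw [haa, hba] at e'
  exact mul_left_cancel₀ (by norm_num) e'

/-- A matrix commuting with every `U ⊗ U` lies in the span of the identity and the swap. -/
theorem covariant_eq_smul_one_add_smul_swap [Nonempty A] {K : Matrix (A × A) (A × A) ℂ}
    (h : ∀ U : Matrix A A ℂ, Uᴴ * U = 1 → (U ⊗ₖ U) * K = K * (U ⊗ₖ U)) :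
    ∃ x y : ℂ, K = x • (1 : Matrix (A × A) (A × A) ℂ) + y • swap A := by
  rcases subsingleton_or_nontrivial A with hA | hA
  · obtain ⟨a⟩ := ‹Nonempty A›
    refine ⟨K (a, a) (a, a), 0, ?_⟩
    ext p q
    obtain rfl : p = (a, a) := Subsingleton.elim _ _
    obtain rfl : q = (a, a) := Subsingleton.elim _ _
    simp
  · obtain ⟨a, b, hab⟩ := exists_pair_ne A
    have hx : ∀ {c d : A}, c ≠ d → K (c, d) (c, d) = K (a, b) (a, b) := by
      intro c d hcd
      obtain ⟨σ, rfl, rfl⟩ := exists_perm_of_ne hab hcd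
      exact perm_covariance h σ _ _ _ _
    have hy : ∀ {c d : A}, c ≠ d → K (c, d) (d, c) = K (a, b) (b, a) := by
      intro c d hcd
      obtain ⟨σ, rfl, rfl⟩ := exists_perm_of_ne hab hcd
      exact perm_covariance h σ _ _ _ _
    refine ⟨K (a, b) (a, b), K (a, b) (b, a), ?_⟩
    ext ⟨i, k⟩ ⟨j, l⟩
    simp only [swapMatrix_apply, Matrix.add_apply, Matrix.smul_apply, Matrix.one_apply,
      Prod.mk.injEq, smul_eq_mul]
    by_cases h₁ : i = j ∧ k = l
    · obtain ⟨rfl, rfl⟩ := h₁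
      by_cases hik : i = k
      · subst hik
        obtain ⟨c, hc⟩ := exists_ne i
        rw [covariant_apply_self h hc.symm, hx hc.symm, hy hc]
        simp
      · simp [hx hik, hik]
    · by_cases h₂ : i = l ∧ k = j
      · obtain ⟨rfl, rfl⟩ := h₂
        have hik : i ≠ k := fun e => h₁ ⟨e, e.symm⟩
        simp [hy hik, hik]
      · simp [covariant_apply_eq_zero h h₁ h₂, h₁, h₂]

end Covariance

theorem swap_conjTranspose {A : Type*} [DecidableEq A] : (swap A)ᴴ = swap A := by
  ext p q
  simp only [swapMatrix_apply, conjTranspose_apply, apply_ite star, star_one, star_zero]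
  congr 1
  simp [eq_comm, and_comm]

section Swap

variable {A : Type*} [Fintype A] [DecidableEq A]

theorem swap_mul_swap : swap A * swap A = 1 := by
  ext p q
  rw [swap_mul_apply]
  simp [swapMatrix_apply, Matrix.one_apply, Prod.ext_iff, and_comm]

theorem kronecker_mul_swap (U : Matrix A A ℂ) : (U ⊗ₖ U) * swap A = swap A * (U ⊗ₖ U) := by
  ext p q
  rw [swap_mul_apply, mul_swap_apply]
  simp [mul_comm]

theorem trB_jordan_swap (x y : ℂ) :
    trB (jordan (swap A) (x • (1 : Matrix (A × A) (A × A) ℂ) + y • swap A)) =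
      (x + y * Fintype.card A) • (1 : Matrix A A ℂ) := by
  have : jordan (swap A) (x • (1 : Matrix (A × A) (A × A) ℂ) + y • swap A) =
      x • swap A + y • (1 : Matrix (A × A) (A × A) ℂ) := by
    simp only [jordan, mul_add, add_mul, mul_smul_comm, smul_mul_assoc, swap_mul_swap, mul_one,
      one_mul]
    module
  rw [this]
  ext i j
  rcases eq_or_ne i j with rfl | hij
  · have hs : ∀ k, (i = k ∧ k = i) ↔ i = k := fun k => by grind
    simp [trB, swapMatrix_apply, Finset.sum_add_distrib, hs, mul_comm]
  · have hs : ∀ k, ¬(i = k ∧ k = j) := fun k => by grind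
    simp [trB, swapMatrix_apply, hij, hs]

theorem smul_card_sub_swap (a : ℝ) :
    a • (Fintype.card A • (1 : Matrix (A × A) (A × A) ℂ) - swap A) =
      ((a : ℂ) * Fintype.card A) • (1 : Matrix (A × A) (A × A) ℂ) + (-(a : ℂ)) • swap A := by
  rw [← Nat.cast_smul_eq_nsmul ℂ, smul_sub, ← Complex.coe_smul, ← Complex.coe_smul, smul_smul,
    neg_smul, sub_eq_add_neg]

end Swap

section Bound

variable {A : Type*} [Fintype A] [DecidableEq A]

theorem IsJam.isHermitian {J : Matrix (A × A) (A × A) ℂ} (hJ : IsJam J) : J.IsHermitian := by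
  ext p q
  have := hJ.1.isHermitian.apply (q.1, p.2) (p.1, q.2)
  simpa [ptA] using this

theorem IsJam.trB_ptA {J : Matrix (A × A) (A × A) ℂ} (hJ : IsJam J) : trB (ptA J) = 1 := by
  ext i j
  have := congrFun (congrFun hJ.2 j) i
  simpa [trB, ptA, Matrix.one_apply, eq_comm] using this

theorem trace_jordan_of_isState {ρ : Matrix A A ℂ} {J : Matrix (A × A) (A × A) ℂ}
    (hρ : IsState ρ) (hJ : IsJam J) :
    (jordan (ρ ⊗ₖ (1 : Matrix A A ℂ)) J).trace = 1 := by
  have h : ((ρ ⊗ₖ (1 : Matrix A A ℂ)) * J).trace = 1 := by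
    have h' : ((ρ ⊗ₖ (1 : Matrix A A ℂ)) * J).trace = (ρ * trB J).trace := by
      simp only [Matrix.trace, Matrix.diag, Matrix.mul_apply, Fintype.sum_prod_type, trB,
        Matrix.of_apply, Matrix.kroneckerMap_apply, Matrix.one_apply, mul_ite, mul_one, mul_zero,
        ite_mul, zero_mul, Finset.sum_ite_eq, Finset.mem_univ, if_true, Finset.mul_sum]
      exact Finset.sum_congr rfl fun i _ => Finset.sum_comm
    rw [h', hJ.2, mul_one, hρ.2]
  rw [jordan, trace_smul, trace_add, trace_mul_comm J, h]
  norm_num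

/-- The entries of a positive semidefinite matrix are bounded by the mean of the diagonal. -/
theorem PosSemidef.two_mul_re_apply_le {n : Type*} [Fintype n] [DecidableEq n]
    {M : Matrix n n ℂ} (hM : M.PosSemidef) (p q : n) :
    2 * (M p q).re ≤ (M p p).re + (M q q).re := by
  have h := hM.dotProduct_mulVec_nonneg (Pi.single p 1 - Pi.single q 1)
  have hs : ∀ r : n, star (Pi.single r 1 : n → ℂ) = Pi.single r 1 := fun r => by
    rw [← Pi.single_star, star_one]
  simp only [star_sub, hs, mulVec_sub, sub_dotProduct, dotProduct_sub, mulVec_single_one,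
    single_one_dotProduct, Matrix.col_apply] at h
  have h' := (Complex.le_def.1 h).1
  have hpq : (M q p).re = (M p q).re := by
    rw [← hM.isHermitian.apply p q]
    simp
  simp only [Complex.sub_re, Complex.zero_re] at h'
  linarith

/-- A positive semidefinite matrix with unit marginal has diagonal entries at most one. -/
theorem re_apply_self_le_one_of_trB_eq_one {Q : Matrix (A × A) (A × A) ℂ} (hQ : Q.PosSemidef)
    (h : trB Q = 1) (p : A × A) : (Q p p).re ≤ 1 := by
  have h1 := congrArg Complex.re (congrFun (congrFun h p.1) p.1)
  simp only [trB, Matrix.of_apply, Matrix.one_apply_eq, Complex.one_re, Complex.re_sum] at h1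
  rw [← h1]
  exact Finset.single_le_sum (f := fun k => (Q (p.1, k) (p.1, k)).re)
    (fun k _ => (Complex.le_def.1 hQ.diag_nonneg).1) (Finset.mem_univ p.2)

theorem trB_conj_kronecker_one (V : Matrix A A ℂ) (P : Matrix (A × A) (A × A) ℂ) :
    trB ((V ⊗ₖ (1 : Matrix A A ℂ))ᴴ * P * (V ⊗ₖ (1 : Matrix A A ℂ))) = Vᴴ * trB P * V := by
  ext i j
  simp only [trB, Matrix.of_apply, Matrix.mul_apply, Fintype.sum_prod_type, conjTranspose_apply,
    Matrix.kroneckerMap_apply, Matrix.one_apply, mul_ite, mul_one, mul_zero, ite_mul, zero_mul,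
    apply_ite star, star_zero, Finset.sum_ite_eq', Finset.mem_univ, if_true, Finset.mul_sum,
    Finset.sum_mul]
  rw [Finset.sum_comm]
  refine Finset.sum_congr rfl fun c _ => ?_
  rw [Finset.sum_comm]

theorem trB_conj_one_kronecker {W : Matrix A A ℂ} (hW : W * Wᴴ = 1)
    (P : Matrix (A × A) (A × A) ℂ) :
    trB (((1 : Matrix A A ℂ) ⊗ₖ W)ᴴ * P * ((1 : Matrix A A ℂ) ⊗ₖ W)) = trB P := by
  ext i j
  let X : Matrix A A ℂ := Matrix.of fun k l => P (i, k) (j, l)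
  have h1 : trB (((1 : Matrix A A ℂ) ⊗ₖ W)ᴴ * P * ((1 : Matrix A A ℂ) ⊗ₖ W)) i j =
      (Wᴴ * X * W).trace := by
    simp [trB, X, Matrix.trace, Matrix.mul_apply, Fintype.sum_prod_type, Matrix.one_apply,
      apply_ite star, Finset.sum_mul]
  rw [h1, trace_mul_comm, ← mul_assoc, hW, one_mul]
  rfl

theorem trB_conj_kronecker {V W : Matrix A A ℂ} (hW : W * Wᴴ = 1)
    (P : Matrix (A × A) (A × A) ℂ) :
    trB ((V ⊗ₖ W)ᴴ * P * (V ⊗ₖ W)) = Vᴴ * trB P * V := by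
  have h : V ⊗ₖ W = ((1 : Matrix A A ℂ) ⊗ₖ W) * (V ⊗ₖ (1 : Matrix A A ℂ)) := by
    rw [← mul_kronecker_mul, one_mul, mul_one]
  rw [h, conjTranspose_mul]
  have h' := trB_conj_kronecker_one V (((1 : Matrix A A ℂ) ⊗ₖ W)ᴴ * P * ((1 : Matrix A A ℂ) ⊗ₖ W))
  rw [trB_conj_one_kronecker hW] at h'
  simpa only [mul_assoc] using h'

theorem trace_swap_mul_kronecker_one_mul (ρ : Matrix A A ℂ) (J : Matrix (A × A) (A × A) ℂ) :
    (swap A * ((ρ ⊗ₖ (1 : Matrix A A ℂ)) * J)).trace =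
      star (vec (1 : Matrix A A ℂ)) ⬝ᵥ (ptA J *ᵥ vec ρ) := by
  simp only [Matrix.trace, Matrix.diag, swap_mul_apply]
  simp [Matrix.mul_apply, dotProduct, mulVec, Fintype.sum_prod_type, vec, ptA,
    Matrix.one_apply, apply_ite star]
  refine Finset.sum_congr rfl fun k _ => ?_
  rw [Finset.sum_comm]
  simp only [mul_comm]

/-- The swap-weighted trace is bounded by the dimension: in an eigenbasis of the state it is a
convex combination of sums of `d` entries, each with real part at most one. -/
theorem re_trace_swap_mul_le {ρ : Matrix A A ℂ} {J : Matrix (A × A) (A × A) ℂ}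
    (hρ : IsState ρ) (hJ : IsJam J) :
    (swap A * ((ρ ⊗ₖ (1 : Matrix A A ℂ)) * J)).trace.re ≤ Fintype.card A := by
  have hH := hρ.1.isHermitian
  let U : Matrix A A ℂ := hH.eigenvectorUnitary
  let e : A → ℝ := hH.eigenvalues
  let V : Matrix A A ℂ := Uᴴᵀ
  let Q : Matrix (A × A) (A × A) ℂ := (V ⊗ₖ U)ᴴ * ptA J * (V ⊗ₖ U)
  have hU : U * Uᴴ = 1 := Unitary.coe_mul_star_self hH.eigenvectorUnitary
  have hV : Vᴴ * V = 1 := by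
    rw [show Vᴴ = Uᵀ by ext; simp [V], ← transpose_mul, mul_eq_one_comm.1 hU, transpose_one]
  have hQ : Q.PosSemidef := hJ.1.conjTranspose_mul_mul_same _
  have hQ1 : trB Q = 1 := by
    rw [trB_conj_kronecker hU, hJ.trB_ptA, mul_one, hV]
  have hρU : ρ = U * diagonal (fun i => (e i : ℂ)) * Uᴴ := by
    have := hH.spectral_theorem
    rw [Unitary.conjStarAlgAut_apply] at this
    exact this
  have hvρ : vec ρ = (V ⊗ₖ U) *ᵥ vec (diagonal (fun i => (e i : ℂ))) := by
    rw [kronecker_mulVec_vec, transpose_transpose, ← hρU]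
  have hv1 : vec (1 : Matrix A A ℂ) = (V ⊗ₖ U) *ᵥ vec (1 : Matrix A A ℂ) := by
    rw [kronecker_mulVec_vec, transpose_transpose, mul_one, hU]
  have hsum : ∑ i, e i = 1 := by
    have := hρ.2
    rw [hH.trace_eq_sum_eigenvalues] at this
    exact Complex.ofReal_injective (by simpa [e] using this)
  have htr : (swap A * ((ρ ⊗ₖ (1 : Matrix A A ℂ)) * J)).trace =
      ∑ m, ∑ n, Q (m, m) (n, n) * e n := by
    rw [trace_swap_mul_kronecker_one_mul, hvρ, hv1, star_mulVec, ← dotProduct_mulVec,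
      mulVec_mulVec, mulVec_mulVec]
    simp [dotProduct, mulVec, Fintype.sum_prod_type, vec, Matrix.one_apply, apply_ite star,
      Matrix.diagonal_apply, Q]
  have hentry : ∀ m n, (Q (m, m) (n, n)).re ≤ 1 := fun m n => by
    have h1 := PosSemidef.two_mul_re_apply_le hQ (m, m) (n, n)
    have h2 := re_apply_self_le_one_of_trB_eq_one hQ hQ1 (m, m)
    have h3 := re_apply_self_le_one_of_trB_eq_one hQ hQ1 (n, n)
    linarith
  rw [htr]
  simp only [Complex.re_sum, Complex.re_mul_ofReal]
  calc ∑ m, ∑ n, (Q (m, m) (n, n)).re * e n ≤ ∑ _m : A, ∑ n, e n := by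
        gcongr with m _ n _
        exact mul_le_of_le_one_left (hρ.1.eigenvalues_nonneg n) (hentry m n)
    _ = Fintype.card A := by simp [hsum]

theorem re_trace_swap_mul_jordan_le {ρ : Matrix A A ℂ} {J : Matrix (A × A) (A × A) ℂ}
    (hρ : IsState ρ) (hJ : IsJam J) :
    (swap A * jordan (ρ ⊗ₖ (1 : Matrix A A ℂ)) J).trace.re ≤ Fintype.card A := by
  have hconj : (swap A * (J * (ρ ⊗ₖ (1 : Matrix A A ℂ)))).trace =
      star (swap A * ((ρ ⊗ₖ (1 : Matrix A A ℂ)) * J)).trace := by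
    rw [← trace_conjTranspose, conjTranspose_mul, conjTranspose_mul, conjTranspose_kronecker,
      hJ.isHermitian.eq, hρ.1.isHermitian.eq, swap_conjTranspose, conjTranspose_one,
      trace_mul_comm]
  have h := re_trace_swap_mul_le hρ hJ
  rw [jordan, mul_smul_comm, mul_add, trace_smul, trace_add, hconj]
  simp only [smul_eq_mul, Complex.mul_re, Complex.add_re, Complex.star_def, Complex.conj_re,
    Complex.add_im, Complex.conj_im]
  norm_num
  linarith

end Bound

section Witness

variable {A : Type*} [Fintype A] [DecidableEq A]

theorem isState_maximallyMixed [Nonempty A] :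
    IsState ((Fintype.card A : ℂ)⁻¹ • (1 : Matrix A A ℂ)) := by
  refine ⟨PosSemidef.one.smul (by positivity), ?_⟩
  rw [trace_smul, trace_one, smul_eq_mul, inv_mul_cancel₀ (by simp)]

theorem isJam_completelyDepolarizing [Nonempty A] :
    IsJam ((Fintype.card A : ℂ)⁻¹ • (1 : Matrix (A × A) (A × A) ℂ)) := by
  have h : ptA ((Fintype.card A : ℂ)⁻¹ • (1 : Matrix (A × A) (A × A) ℂ)) =
      (Fintype.card A : ℂ)⁻¹ • (1 : Matrix (A × A) (A × A) ℂ) := by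
    ext p q
    simp [ptA, Matrix.one_apply, Prod.ext_iff, eq_comm]
  refine ⟨?_, ?_⟩
  · rw [h]
    exact PosSemidef.one.smul (by positivity)
  · ext i j
    by_cases hij : i = j <;> simp [trB, Matrix.one_apply, hij]

theorem trace_swap : (swap A).trace = Fintype.card A := by
  have h : ∀ i j : A, (i = j ∧ j = i) ↔ i = j := fun i j => by grind
  rw [Matrix.trace, Fintype.sum_prod_type]
  simp [swapMatrix_apply, h]

theorem jordan_maximallyMixed :
    jordan (((Fintype.card A : ℂ)⁻¹ • (1 : Matrix A A ℂ)) ⊗ₖ (1 : Matrix A A ℂ))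
      ((Fintype.card A : ℂ)⁻¹ • (1 : Matrix (A × A) (A × A) ℂ)) =
      ((Fintype.card A : ℂ)⁻¹ ^ 2) • (1 : Matrix (A × A) (A × A) ℂ) := by
  rw [smul_kronecker, one_kronecker_one, jordan]
  simp only [smul_mul_smul_comm, mul_one]
  module

end Witness

theorem stmt14 {A : Type*} [Fintype A] [Nonempty A] [DecidableEq A]
    (K : Matrix (A × A) (A × A) ℂ) (hK : K.IsHermitian) :
    ((∀ (ρ : Matrix A A ℂ) (J : Matrix (A × A) (A × A) ℂ), IsState ρ → IsJam J →
        0 ≤ (Matrix.trace (K * jordan (ρ ⊗ₖ (1 : Matrix A A ℂ)) J)).re) ∧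
      trB (jordan (swap A) K) = 0 ∧
      (∀ U : Matrix A A ℂ, Uᴴ * U = 1 → (U ⊗ₖ U) * K = K * (U ⊗ₖ U))) ↔
    (∃ a : ℝ, 0 ≤ a ∧
      K = a • (Fintype.card A • (1 : Matrix (A × A) (A × A) ℂ) - swap A)) := by
  constructor
  · rintro ⟨hpos, hB, hU⟩
    obtain ⟨x, y, rfl⟩ := covariant_eq_smul_one_add_smul_swap hU
    rw [trB_jordan_swap] at hB
    have hx : x = -(y * Fintype.card A) := by
      obtain ⟨i⟩ := ‹Nonempty A›
      have := congrFun (congrFun hB i) i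
      simp only [Matrix.smul_apply, Matrix.one_apply_eq, smul_eq_mul, mul_one,
        Matrix.zero_apply] at this
      exact eq_neg_of_add_eq_zero_left this
    subst hx
    rcases subsingleton_or_nontrivial A with hA | hA
    · refine ⟨0, le_rfl, ?_⟩
      have hd : Fintype.card A = 1 :=
        le_antisymm (Fintype.card_le_one_iff_subsingleton.2 hA) Fintype.card_pos
      ext p q
      simp [Subsingleton.elim p q, swapMatrix_apply, Subsingleton.elim q.1 q.2, hd]
    obtain ⟨a, b, hab⟩ := exists_pair_ne A
    have hy : (y.re : ℂ) = y := by
      have := hK.apply (a, b) (b, a)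
      simp [swapMatrix_apply, hab, hab.symm] at this
      exact Complex.conj_eq_iff_re.1 this
    refine ⟨-y.re, ?_, ?_⟩
    · have h := hpos _ _ isState_maximallyMixed isJam_completelyDepolarizing
      rw [jordan_maximallyMixed, mul_smul_comm, mul_one, trace_smul, trace_add, trace_smul,
        trace_smul, trace_one, trace_swap, Fintype.card_prod, ← hy] at h
      have hd : (1 : ℝ) < Fintype.card A := by exact_mod_cast Fintype.one_lt_card
      have hr : (((Fintype.card A : ℂ)⁻¹ ^ 2) • (-((y.re : ℂ) * Fintype.card A) •
          ((Fintype.card A * Fintype.card A : ℕ) : ℂ) + (y.re : ℂ) • (Fintype.card A : ℂ))) =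
          ((-y.re * ((Fintype.card A : ℝ)⁻¹ ^ 2 * (Fintype.card A : ℝ) *
            ((Fintype.card A : ℝ) ^ 2 - 1)) : ℝ) : ℂ) := by
        push_cast
        simp only [smul_eq_mul]
        ring
      rw [hr, Complex.ofReal_re] at h
      refine nonneg_of_mul_nonneg_left h ?_
      have : 0 < (Fintype.card A : ℝ) ^ 2 - 1 := by nlinarith
      positivity
    · rw [smul_card_sub_swap, Complex.ofReal_neg, hy, neg_neg, neg_mul]
  · rintro ⟨a, ha, rfl⟩
    refine ⟨fun ρ J hρ hJ => ?_, ?_, fun U _ => ?_⟩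
    · have h := re_trace_swap_mul_jordan_le hρ hJ
      rw [smul_mul_assoc, sub_mul, smul_mul_assoc, one_mul, trace_smul, trace_sub, trace_smul,
        trace_jordan_of_isState hρ hJ]
      simp only [Complex.smul_re, Complex.sub_re, smul_eq_mul, nsmul_eq_mul]
      exact mul_nonneg ha (by simpa using h)
    · rw [smul_card_sub_swap, trB_jordan_swap]
      simp
    · rw [smul_card_sub_swap]
      simp only [mul_add, add_mul, mul_smul_comm, smul_mul_assoc, mul_one, one_mul,
        kronecker_mul_swap]
end
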